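/- arXiv:2212.06983 — 3 statements merged into one kernel-verified Lean document; each statement's English description precedes it below -/
import Mathlib

section
/- (Proposition 1, convergence of the inner loop.) Assume Assumptions 1 and 3 hold and K contains at least one strictly feasible point (w̃ ∈ W with x_i(w̃) > a_i and y_j(w̃) < b_j for all i, j). Fix w^k ∈ K and generate η^{l+1} = [η^l + α^l g(ŵ(λ^k, η^l))]_+ from any η^0 ≥ 0, where [·]_+ denotes the componentwise positive part and the step size α^l is chosen by the Armijo rule along the projection arc: given α_init > 0 and σ, β ∈ (0,1), α^l is the largest element of {α_init β^j : j = 0, 1, …} satisfying h(η^{l+1}) − h(η^l) ≥ σ g(ŵ(λ^k, η^l))ᵀ(η^{l+1} − η^l). Then the sequence {ŵ(λ^k, η^l)}_{l=1}^∞ converges to the optimal solution of the convex problem minimize_{w∈K} f̃(w; w^k). -/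
/- STATEMENT 1 (Proposition 1, convergence of the inner loop): under Assumptions 1 and 3
and strict feasibility of K, fixing w^k ∈ K, the dual gradient-projection iteration
η^{l+1} = [η^l + α^l g(ŵ(λ^k, η^l))]_+ with Armijo step sizes along the projection arc
produces a sequence {ŵ(λ^k, η^l)} converging to the optimal solution of the convex
problem minimize_{w∈K} f̃(w; w^k). -/

noncomputable section
open Matrix Filter

/-- The standard simplex `W = {w : w ≥ 0, 1ᵀw = 1}`. -/
def simplex (N : ℕ) : Set (Fin N → ℝ) := {w | (∀ i, 0 ≤ w i) ∧ ∑ i, w i = 1}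

/-- Expected returns `x_i(w) = wᵀμ_i`. -/
def xf {N p : ℕ} (μ : Fin p → Fin N → ℝ) (w : Fin N → ℝ) (i : Fin p) : ℝ := w ⬝ᵥ μ i

/-- Risks `y_j(w) = wᵀΣ_j w`. -/
def yf {N q : ℕ} (S : Fin q → Matrix (Fin N) (Fin N) ℝ) (w : Fin N → ℝ) (j : Fin q) : ℝ :=
  w ⬝ᵥ (S j).mulVec w

/-- Feasible set `K = {w ∈ W : x(w) ≥ a, y(w) ≤ b}`. -/
def Kset {N p q : ℕ} (μ : Fin p → Fin N → ℝ) (S : Fin q → Matrix (Fin N) (Fin N) ℝ)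
    (a : Fin p → ℝ) (b : Fin q → ℝ) : Set (Fin N → ℝ) :=
  {w ∈ simplex N | (∀ i, a i ≤ xf μ w i) ∧ (∀ j, yf S w j ≤ b j)}

/-- Gradient of `f(w) = F(x(w), y(w))` by the chain rule. -/
def gradf {N p q : ℕ} (μ : Fin p → Fin N → ℝ) (S : Fin q → Matrix (Fin N) (Fin N) ℝ)
    (Fx : (Fin p → ℝ) → (Fin q → ℝ) → Fin p → ℝ)
    (Fy : (Fin p → ℝ) → (Fin q → ℝ) → Fin q → ℝ)
    (w : Fin N → ℝ) : Fin N → ℝ :=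
  fun n => ∑ i, Fx (xf μ w) (yf S w) i * μ i n
    + ∑ j, 2 * Fy (xf μ w) (yf S w) j * (S j).mulVec w n

/-- The quadratic surrogate `f̃(w; w̄) = ∇_xF(x(w̄),y(w̄))ᵀ x(w) + ∇_yF(x(w̄),y(w̄))ᵀ y(w)`. -/
def ftilde {N p q : ℕ} (μ : Fin p → Fin N → ℝ) (S : Fin q → Matrix (Fin N) (Fin N) ℝ)
    (Fx : (Fin p → ℝ) → (Fin q → ℝ) → Fin p → ℝ)
    (Fy : (Fin p → ℝ) → (Fin q → ℝ) → Fin q → ℝ)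
    (wbar w : Fin N → ℝ) : ℝ :=
  Fx (xf μ wbar) (yf S wbar) ⬝ᵥ xf μ w + Fy (xf μ wbar) (yf S wbar) ⬝ᵥ yf S w

/-- The constraint function `g(w) ∈ ℝ^{p+q}`: `g_i(w) = a_i − x_i(w)` and
`g_{p+j}(w) = y_j(w) − b_j`. -/
def gvec {N p q : ℕ} (μ : Fin p → Fin N → ℝ) (S : Fin q → Matrix (Fin N) (Fin N) ℝ)
    (a : Fin p → ℝ) (b : Fin q → ℝ) (w : Fin N → ℝ) : Fin p ⊕ Fin q → ℝ :=
  Sum.elim (fun i => a i - xf μ w i) (fun j => yf S w j - b j)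

/-- The partial Lagrangian `L(w, η) = f̃(w; w^k) + ηᵀ g(w)`, i.e.
`f̃(w; w^k) + η_xᵀ(a − x(w)) + η_yᵀ(y(w) − b)`. -/
def Lagr {N p q : ℕ} (μ : Fin p → Fin N → ℝ) (S : Fin q → Matrix (Fin N) (Fin N) ℝ)
    (Fx : (Fin p → ℝ) → (Fin q → ℝ) → Fin p → ℝ)
    (Fy : (Fin p → ℝ) → (Fin q → ℝ) → Fin q → ℝ)
    (a : Fin p → ℝ) (b : Fin q → ℝ)
    (wk w : Fin N → ℝ) (η : Fin p ⊕ Fin q → ℝ) : ℝ :=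
  ftilde μ S Fx Fy wk w + η ⬝ᵥ gvec μ S a b w

/-- One projected step of the dual iteration: `[η + s*g]_+` componentwise. -/
def etaCand {p q : ℕ} (g η : Fin p ⊕ Fin q → ℝ) (s : ℝ) : Fin p ⊕ Fin q → ℝ :=
  fun t => max 0 (η t + s * g t)

/-- A projected step `u = [x + s γ]_+ - x` from `x ≥ 0` satisfies `u² ≤ s γ u`. -/
lemma sq_projStep_le {x γ s : ℝ} (hx : 0 ≤ x) :
    (max 0 (x + s * γ) - x) ^ 2 ≤ s * (γ * (max 0 (x + s * γ) - x)) := by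
  rcases le_total 0 (x + s * γ) with h | h
  · rw [max_eq_right h]
    exact le_of_eq (by ring)
  · rw [max_eq_left h]
    nlinarith

/-- If `u` is a projected step of length at least `m > 0`, then `γ ≤ |u| / m`. -/
lemma le_abs_projStep_div {x γ s m : ℝ} (hm : 0 < m) (hms : m ≤ s) :
    γ ≤ |max 0 (x + s * γ) - x| / m := by
  rw [le_div_iff₀ hm]
  rcases le_total γ 0 with h | h
  · exact (mul_nonpos_of_nonpos_of_nonneg h hm.le).trans (abs_nonneg _)
  · have h1 := le_max_right 0 (x + s * γ)
    have h2 := le_abs_self (max 0 (x + s * γ) - x)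
    nlinarith

/-- If `u` is a projected step of length at least `m > 0` from `x ∈ [0, B]`, and `|γ| ≤ G`, then
`-x γ` is controlled by `|u|`. -/
lemma neg_mul_le_abs_projStep {x γ s m B G : ℝ} (hx : 0 ≤ x) (hm : 0 < m) (hms : m ≤ s)
    (hB : x ≤ B) (hG : |γ| ≤ G) :
    -(x * γ) ≤ (B / m + G) * |max 0 (x + s * γ) - x| := by
  have hG0 : 0 ≤ G := (abs_nonneg _).trans hG
  have hB0 : 0 ≤ B / m := div_nonneg (hx.trans hB) hm.le
  rcases le_total 0 (x + s * γ) with h | h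
  · have h1 : |γ| ≤ |s * γ| / m := by
      rw [le_div_iff₀ hm, abs_mul, abs_of_pos (hm.trans_le hms), mul_comm]
      exact mul_le_mul_of_nonneg_right hms (abs_nonneg _)
    have h2 : -(x * γ) ≤ B * (|s * γ| / m) := by
      calc -(x * γ) = x * -γ := by ring
        _ ≤ x * |γ| := mul_le_mul_of_nonneg_left (neg_le_abs γ) hx
        _ ≤ B * (|s * γ| / m) := mul_le_mul hB h1 (abs_nonneg _) (hx.trans hB)
    rw [max_eq_right h, show x + s * γ - x = s * γ by ring]
    calc -(x * γ) ≤ B * (|s * γ| / m) := h2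
      _ = B / m * |s * γ| := by ring
      _ ≤ (B / m + G) * |s * γ| :=
          mul_le_mul_of_nonneg_right (by linarith) (abs_nonneg _)
  · rw [max_eq_left h, zero_sub, abs_neg, abs_of_nonneg hx]
    nlinarith [neg_le_abs γ, mul_nonneg hB0 hx]

/-- Uniform quadratic growth of the Lagrangian and Lipschitz constraints bound the dual function
below by its linearization minus a quadratic. -/
lemma linearization_sub_quadratic_le {E ι : Type*} [NormedAddCommGroup E] [Fintype ι] {W : Set E}
    {φ : E → ℝ} {g : E → ι → ℝ} {K : NNReal} (hg : LipschitzOnWith K g W) {c : ℝ} (hc : 0 < c)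
    {what : (ι → ℝ) → E} (hmem : ∀ η, 0 ≤ η → what η ∈ W)
    (hgrow : ∀ η, 0 ≤ η → ∀ w ∈ W,
      φ (what η) + η ⬝ᵥ g (what η) + c * ‖w - what η‖ ^ 2 ≤ φ w + η ⬝ᵥ g w)
    {η η' : ι → ℝ} (hη : 0 ≤ η) (hη' : 0 ≤ η') :
    φ (what η) + η ⬝ᵥ g (what η) + g (what η) ⬝ᵥ (η' - η)
        - (K ^ 2 * Fintype.card ι / (4 * c) + 1) * ((η' - η) ⬝ᵥ (η' - η))
      ≤ φ (what η') + η' ⬝ᵥ g (what η') := by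
  set u := η' - η with hu
  set D := ‖what η' - what η‖
  set A := ∑ t, |u t|
  have h1 := hgrow η hη _ (hmem η' hη')
  have h2 : η' ⬝ᵥ g (what η')
      = η ⬝ᵥ g (what η') + g (what η) ⬝ᵥ u + u ⬝ᵥ (g (what η') - g (what η)) := by
    rw [dotProduct_comm (g (what η)) u, add_assoc, ← dotProduct_add, add_sub_cancel, hu,
      sub_dotProduct]
    ring
  have h3 : -(K * D * A) ≤ u ⬝ᵥ (g (what η') - g (what η)) := by
    have hL := hg.dist_le_mul _ (hmem η' hη') _ (hmem η hη)
    rw [dist_eq_norm, dist_eq_norm] at hL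
    rw [dotProduct, Finset.mul_sum, ← Finset.sum_neg_distrib]
    refine Finset.sum_le_sum fun t _ => ?_
    have ht : |(g (what η') - g (what η)) t| ≤ K * D := (norm_le_pi_norm _ t).trans hL
    have := neg_abs_le (u t * (g (what η') - g (what η)) t)
    rw [abs_mul] at this
    nlinarith [mul_le_mul_of_nonneg_left ht (abs_nonneg (u t))]
  have h4 : A ^ 2 ≤ Fintype.card ι * (u ⬝ᵥ u) := by
    have := sq_sum_le_card_mul_sum_sq (s := Finset.univ) (f := fun t => |u t|)
    simpa [sq_abs, dotProduct, ← sq] using this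
  have huu : 0 ≤ u ⬝ᵥ u := by
    rw [dotProduct]
    exact Finset.sum_nonneg fun t _ => mul_self_nonneg _
  have h5 : K * D * A ≤ c * D ^ 2 + K ^ 2 / (4 * c) * A ^ 2 := by
    have : c * D ^ 2 + K ^ 2 / (4 * c) * A ^ 2 - K * D * A
        = (2 * c * D - K * A) ^ 2 / (4 * c) := by
      field_simp
      ring
    have : 0 ≤ (2 * c * D - K * A) ^ 2 / (4 * c) := by positivity
    linarith
  have h6 : (K : ℝ) ^ 2 / (4 * c) * A ^ 2 ≤ K ^ 2 * Fintype.card ι / (4 * c) * (u ⬝ᵥ u) := by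
    calc (K : ℝ) ^ 2 / (4 * c) * A ^ 2 ≤ K ^ 2 / (4 * c) * (Fintype.card ι * (u ⬝ᵥ u)) :=
          mul_le_mul_of_nonneg_left h4 (by positivity)
      _ = _ := by ring
  linarith

/-- Convergence of dual gradient projection with Armijo steps along the projection arc, for a
Lagrangian with uniform quadratic growth around its minimizers. -/
theorem tendsto_of_armijo_dual_ascent {E ι : Type*} [NormedAddCommGroup E] [Fintype ι] {W : Set E}
    (hW : IsCompact W) {φ : E → ℝ} (hφ : Continuous φ) {g : E → ι → ℝ} (hgc : Continuous g)
    {K : NNReal} (hg : LipschitzOnWith K g W) {c : ℝ} (hc : 0 < c)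
    {what : (ι → ℝ) → E} (hmem : ∀ η, 0 ≤ η → what η ∈ W)
    (hgrow : ∀ η, 0 ≤ η → ∀ w ∈ W,
      φ (what η) + η ⬝ᵥ g (what η) + c * ‖w - what η‖ ^ 2 ≤ φ w + η ⬝ᵥ g w)
    (hslater : ∃ w ∈ W, ∀ t, g w t < 0)
    {αinit σ β : ℝ} (hα : 0 < αinit) (hσ : σ ∈ Set.Ioo (0 : ℝ) 1) (hβ : β ∈ Set.Ioo (0 : ℝ) 1)
    {h : (ι → ℝ) → ℝ} (hh : ∀ η, h η = φ (what η) + η ⬝ᵥ g (what η))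
    {step : (ι → ℝ) → ℝ → ι → ℝ}
    (hstep : ∀ η s t, step η s t = max 0 (η t + s * g (what η) t))
    {ηs : ℕ → ι → ℝ} {αs : ℕ → ℝ} (hη0 : 0 ≤ ηs 0)
    (hupd : ∀ l, ηs (l + 1) = step (ηs l) (αs l))
    (harm : ∀ l, ∃ j : ℕ, αs l = αinit * β ^ j ∧
      σ * (g (what (ηs l)) ⬝ᵥ (step (ηs l) (αs l) - ηs l)) ≤ h (step (ηs l) (αs l)) - h (ηs l) ∧
      ∀ j' < j, ¬ σ * (g (what (ηs l)) ⬝ᵥ (step (ηs l) (αinit * β ^ j') - ηs l)) ≤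
        h (step (ηs l) (αinit * β ^ j')) - h (ηs l)) :
    ∃ wopt ∈ {w ∈ W | ∀ t, g w t ≤ 0}, (∀ w ∈ {w ∈ W | ∀ t, g w t ≤ 0}, φ wopt ≤ φ w) ∧
      Tendsto (fun l => what (ηs l)) atTop (nhds wopt) := by
  obtain ⟨ws, hws, hwsneg⟩ := hslater
  have hgt : ∀ t, Continuous fun w => g w t := fun t => (continuous_apply t).comp hgc
  have hclosed : IsClosed {w | ∀ t, g w t ≤ 0} := by
    simp only [Set.ofPred_forall]
    exact isClosed_iInter fun t => isClosed_le (hgt t) continuous_const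
  obtain ⟨wo, hwo, hmin⟩ := (hW.inter_right hclosed).exists_isMinOn
    ⟨ws, hws, fun t => (hwsneg t).le⟩ hφ.continuousOn
  refine ⟨wo, hwo, fun w hw => hmin hw, ?_⟩
  have hηnn : ∀ l, 0 ≤ ηs l := by
    intro l
    cases l with
    | zero => exact hη0
    | succ l =>
      rw [hupd]
      intro t
      rw [hstep]
      exact le_max_left _ _
  have hstepnn : ∀ η s, 0 ≤ step η s := fun η s t => by
    rw [hstep]
    exact le_max_left _ _
  have hsq : ∀ η s, 0 ≤ η →
      (step η s - η) ⬝ᵥ (step η s - η) ≤ s * (g (what η) ⬝ᵥ (step η s - η)) := by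
    intro η s hη
    rw [dotProduct, dotProduct, Finset.mul_sum]
    refine Finset.sum_le_sum fun t _ => ?_
    rw [Pi.sub_apply, hstep, ← sq]
    exact sq_projStep_le (hη t)
  have hdot : ∀ u : ι → ℝ, 0 ≤ u ⬝ᵥ u := fun u =>
    Finset.sum_nonneg fun t _ => mul_self_nonneg _
  -- the step sizes are bounded below
  obtain ⟨hσ0, hσ1⟩ := hσ
  obtain ⟨hβ0, hβ1⟩ := hβ
  set M : ℝ := K ^ 2 * Fintype.card ι / (4 * c) + 1 with hM
  have hMpos : 0 < M := by positivity
  have harmOK : ∀ η s, 0 ≤ η → 0 < s → M * s ≤ 1 - σ →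
      σ * (g (what η) ⬝ᵥ (step η s - η)) ≤ h (step η s) - h η := by
    intro η s hη hs hMs
    have h1 := linearization_sub_quadratic_le hg hc hmem hgrow hη (hstepnn η s)
    have h2 := hsq η s hη
    rw [hh, hh]
    set P := g (what η) ⬝ᵥ (step η s - η)
    set Q := (step η s - η) ⬝ᵥ (step η s - η)
    have hQ : 0 ≤ Q := hdot _
    have hP : 0 ≤ P := by
      by_contra hneg
      push Not at hneg
      nlinarith
    have h3 : M * Q ≤ (1 - σ) * P := by
      calc M * Q ≤ M * (s * P) := mul_le_mul_of_nonneg_left h2 hMpos.le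
        _ = (M * s) * P := by ring
        _ ≤ (1 - σ) * P := mul_le_mul_of_nonneg_right hMs hP
    linarith
  obtain ⟨m, hm, hmα⟩ : ∃ m, 0 < m ∧ ∀ l, m ≤ αs l := by
    refine ⟨min αinit (β * ((1 - σ) / M)),
      lt_min hα (mul_pos hβ0 (div_pos (by linarith) hMpos)), fun l => ?_⟩
    obtain ⟨j, hj, -, hj'⟩ := harm l
    cases j with
    | zero => simp [hj]
    | succ j =>
      refine (min_le_right _ _).trans ?_
      have hs : 0 < αinit * β ^ j := by positivity
      have : (1 - σ) / M ≤ αinit * β ^ j := by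
        rw [div_le_iff₀ hMpos]
        by_contra hlt
        push Not at hlt
        exact hj' j (Nat.lt_succ_self j) (harmOK _ _ (hηnn l) hs (by linarith))
      rw [hj, pow_succ]
      nlinarith
  have hαle : ∀ l, αs l ≤ αinit := by
    intro l
    obtain ⟨j, hj, -⟩ := harm l
    rw [hj]
    exact mul_le_of_le_one_right hα.le (pow_le_one₀ hβ0.le hβ1.le)
  -- the dual values increase and converge
  set P : ℕ → ℝ := fun l => g (what (ηs l)) ⬝ᵥ (ηs (l + 1) - ηs l) with hPdef
  have hPinc : ∀ l, σ * P l ≤ h (ηs (l + 1)) - h (ηs l) := by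
    intro l
    obtain ⟨j, -, hj, -⟩ := harm l
    simpa only [hPdef, hupd] using hj
  have hQP : ∀ l, (ηs (l + 1) - ηs l) ⬝ᵥ (ηs (l + 1) - ηs l) ≤ αs l * P l := by
    intro l
    simpa only [hPdef, hupd] using hsq (ηs l) (αs l) (hηnn l)
  have hP0 : ∀ l, 0 ≤ P l := by
    intro l
    by_contra hneg
    push Not at hneg
    nlinarith [hQP l, hdot (ηs (l + 1) - ηs l), mul_pos_of_neg_of_neg hneg
      (neg_neg_of_pos (hm.trans_le (hmα l)))]
  have hmono : Monotone fun l => h (ηs l) := monotone_nat_of_le_succ fun l => by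
    nlinarith [hPinc l, mul_nonneg hσ0.le (hP0 l)]
  have hle : ∀ η, 0 ≤ η → ∀ w ∈ W, h η ≤ φ w + η ⬝ᵥ g w := fun η hη w hw => by
    have := hgrow η hη w hw
    rw [hh]
    nlinarith [mul_nonneg hc.le (sq_nonneg ‖w - what η‖)]
  have hfeas : ∀ η : ι → ℝ, 0 ≤ η → ∀ w, (∀ t, g w t ≤ 0) → η ⬝ᵥ g w ≤ 0 := fun η hη w hw =>
    Finset.sum_nonpos fun t _ => mul_nonpos_of_nonneg_of_nonpos (hη t) (hw t)
  have hbdd : BddAbove (Set.range fun l => h (ηs l)) := by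
    refine ⟨φ wo, ?_⟩
    rintro _ ⟨l, rfl⟩
    have := hle _ (hηnn l) wo hwo.1
    have := hfeas _ (hηnn l) wo hwo.2
    simp only
    linarith
  have hlim := tendsto_atTop_ciSup hmono hbdd
  have hPlim : Tendsto P atTop (nhds 0) := by
    have h1 : Tendsto (fun l => (h (ηs (l + 1)) - h (ηs l)) / σ) atTop (nhds 0) := by
      simpa using ((hlim.comp (tendsto_add_atTop_nat 1)).sub hlim).div_const σ
    refine squeeze_zero hP0 (fun l => ?_) h1
    rw [le_div_iff₀ hσ0, mul_comm]
    exact hPinc l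
  have hulim : ∀ t, Tendsto (fun l => |ηs (l + 1) t - ηs l t|) atTop (nhds 0) := by
    intro t
    have h1 : Tendsto (fun l => Real.sqrt (αinit * P l)) atTop (nhds 0) := by
      simpa using (hPlim.const_mul αinit).sqrt
    refine squeeze_zero (fun l => abs_nonneg _) (fun l => Real.abs_le_sqrt ?_) h1
    have h2 : (ηs (l + 1) t - ηs l t) ^ 2
        ≤ (ηs (l + 1) - ηs l) ⬝ᵥ (ηs (l + 1) - ηs l) := by
      rw [sq]
      exact Finset.single_le_sum (f := fun t => (ηs (l + 1) - ηs l) t * (ηs (l + 1) - ηs l) t)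
        (fun t _ => mul_self_nonneg _) (Finset.mem_univ t)
    exact h2.trans ((hQP l).trans (mul_le_mul_of_nonneg_right (hαle l) (hP0 l)))
  -- Slater's condition bounds the multipliers
  obtain ⟨B, hB⟩ : ∃ B : ι → ℝ, ∀ l t, ηs l t ≤ B t := by
    refine ⟨fun t => (φ ws - h (ηs 0)) / (-g ws t), fun l t => ?_⟩
    rw [le_div_iff₀ (neg_pos.mpr (hwsneg t))]
    have h1 := hle _ (hηnn l) ws hws
    have h2 : h (ηs 0) ≤ h (ηs l) := hmono (Nat.zero_le l)
    have h3 : ηs l t * -g ws t ≤ ∑ t, ηs l t * -g ws t :=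
      Finset.single_le_sum (f := fun t => ηs l t * -g ws t)
        (fun t _ => mul_nonneg (hηnn l t) (neg_pos.mpr (hwsneg t)).le) (Finset.mem_univ t)
    have h4 : ∑ t, ηs l t * -g ws t = -(ηs l ⬝ᵥ g ws) := by
      simp [dotProduct]
    linarith
  obtain ⟨G, hG⟩ : ∃ G : ℝ, ∀ w ∈ W, ‖g w‖ ≤ G := hW.exists_bound_of_continuousOn hgc.continuousOn
  set R : ℕ → ℝ := fun l => ∑ t, (B t / m + G) * |ηs (l + 1) t - ηs l t| with hR
  have hRlim : Tendsto R atTop (nhds 0) := by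
    have := tendsto_finsetSum Finset.univ
      fun t _ => (hulim t).const_mul (B t / m + G)
    simpa using this
  have hcompl : ∀ l, -(ηs l ⬝ᵥ g (what (ηs l))) ≤ R l := by
    intro l
    rw [dotProduct, ← Finset.sum_neg_distrib]
    refine Finset.sum_le_sum fun t _ => ?_
    rw [hupd, hstep]
    exact neg_mul_le_abs_projStep (hηnn l t) hm (hmα l) (hB l t)
      ((norm_le_pi_norm _ t).trans (hG _ (hmem _ (hηnn l))))
  have hviol : ∀ l t, g (what (ηs l)) t ≤ |ηs (l + 1) t - ηs l t| / m := by
    intro l t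
    rw [hupd, hstep]
    exact le_abs_projStep_div hm (hmα l)
  -- every subsequential limit is the minimizer
  refine tendsto_of_subseq_tendsto fun ns hns => ?_
  obtain ⟨wb, hwb, ψ, hψ, hlimψ⟩ := hW.isSeqCompact fun n => hmem _ (hηnn (ns n))
  refine ⟨ψ, ?_⟩
  have hsub : Tendsto (fun n => ns (ψ n)) atTop atTop := hns.comp hψ.tendsto_atTop
  have hwbK : ∀ t, g wb t ≤ 0 := fun t => by
    refine le_of_tendsto_of_tendsto' ((hgt t).continuousAt.tendsto.comp hlimψ) ?_
      (fun n => hviol (ns (ψ n)) t)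
    simpa using ((hulim t).comp hsub).div_const m
  have hkey : c * ‖wo - wb‖ ^ 2 ≤ φ wo - φ wb + 0 := by
    refine le_of_tendsto_of_tendsto' (((hlimψ.const_sub wo).norm.pow 2).const_mul c)
      ((((hφ.continuousAt.tendsto.comp hlimψ).const_sub (φ wo))).add (hRlim.comp hsub)) fun n => ?_
    have h1 := hgrow _ (hηnn (ns (ψ n))) wo hwo.1
    have h2 := hfeas _ (hηnn (ns (ψ n))) wo hwo.2
    have h3 := hcompl (ns (ψ n))
    simp only [Function.comp_apply]
    linarith
  have hopt : φ wo ≤ φ wb := hmin ⟨hwb, hwbK⟩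
  have hnorm : ‖wo - wb‖ ^ 2 ≤ 0 := by
    by_contra hpos
    push Not at hpos
    nlinarith [mul_pos hc hpos]
  have heq : wo = wb := by
    have : ‖wo - wb‖ = 0 := by
      have := sq_nonneg ‖wo - wb‖
      exact pow_eq_zero_iff (two_ne_zero) |>.mp (le_antisymm hnorm this)
    exact sub_eq_zero.mp (norm_eq_zero.mp this)
  rw [heq]
  exact hlimψ

/-- A positive definite quadratic form dominates a multiple of the squared norm. -/
lemma exists_mul_norm_sq_le_dotProduct_mulVec {n : Type*} [Fintype n] {A : Matrix n n ℝ}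
    (hA : A.PosDef) : ∃ c, 0 < c ∧ ∀ d : n → ℝ, c * ‖d‖ ^ 2 ≤ d ⬝ᵥ A.mulVec d := by
  have hpos : ∀ d : n → ℝ, d ≠ 0 → 0 < d ⬝ᵥ A.mulVec d := fun d hd => by
    simpa using hA.dotProduct_mulVec_pos hd
  have hcont : Continuous fun d : n → ℝ => d ⬝ᵥ A.mulVec d := by fun_prop
  rcases (Metric.sphere (0 : n → ℝ) 1).eq_empty_or_nonempty with he | hne
  · refine ⟨1, one_pos, fun d => ?_⟩
    by_cases hd : d = 0
    · simp [hd]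
    · have : ‖d‖⁻¹ • d ∈ Metric.sphere (0 : n → ℝ) 1 := by
        simp [norm_smul, hd]
      simp [he] at this
  · obtain ⟨e, he, hmin⟩ := (isCompact_sphere (0 : n → ℝ) 1).exists_isMinOn hne hcont.continuousOn
    refine ⟨e ⬝ᵥ A.mulVec e, hpos e (ne_zero_of_mem_unit_sphere ⟨e, he⟩), fun d => ?_⟩
    by_cases hd : d = 0
    · simp [hd]
    · have hd' : 0 < ‖d‖ := norm_pos_iff.mpr hd
      have hs : ‖d‖⁻¹ • d ∈ Metric.sphere (0 : n → ℝ) 1 := by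
        simp [norm_smul, hd]
      have h1 : e ⬝ᵥ A.mulVec e ≤ (‖d‖⁻¹ • d) ⬝ᵥ A.mulVec (‖d‖⁻¹ • d) := hmin hs
      rw [mulVec_smul, dotProduct_smul, smul_dotProduct, smul_eq_mul, smul_eq_mul] at h1
      calc e ⬝ᵥ A.mulVec e * ‖d‖ ^ 2
          ≤ ‖d‖⁻¹ * (‖d‖⁻¹ * d ⬝ᵥ A.mulVec d) * ‖d‖ ^ 2 :=
            mul_le_mul_of_nonneg_right h1 (by positivity)
        _ = d ⬝ᵥ A.mulVec d := by field_simp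

/-- The parallelogram identity for a quadratic form, at the midpoint. -/
lemma dotProduct_mulVec_midpoint {n : Type*} [Fintype n] (A : Matrix n n ℝ) (v w : n → ℝ) :
    ((1 / 2 : ℝ) • (v + w)) ⬝ᵥ A.mulVec ((1 / 2 : ℝ) • (v + w))
      = (v ⬝ᵥ A.mulVec v + w ⬝ᵥ A.mulVec w) / 2 - (w - v) ⬝ᵥ A.mulVec (w - v) / 4 := by
  simp only [mulVec_smul, mulVec_add, mulVec_sub, dotProduct_smul, smul_dotProduct, smul_eq_mul,
    add_dotProduct, sub_dotProduct, dotProduct_add, dotProduct_sub]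
  ring

lemma isCompact_simplex (N : ℕ) : IsCompact (simplex N) := isCompact_stdSimplex ℝ (Fin N)

lemma midpoint_mem_simplex {N : ℕ} {v w : Fin N → ℝ} (hv : v ∈ simplex N) (hw : w ∈ simplex N) :
    (1 / 2 : ℝ) • (v + w) ∈ simplex N := by
  rw [smul_add]
  exact convex_stdSimplex ℝ (Fin N) hv hw (by norm_num) (by norm_num) (by norm_num)

section Midpoint

variable {N p q : ℕ} (μ : Fin p → Fin N → ℝ) (S : Fin q → Matrix (Fin N) (Fin N) ℝ)

lemma xf_midpoint (v w : Fin N → ℝ) :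
    xf μ ((1 / 2 : ℝ) • (v + w)) = (1 / 2 : ℝ) • (xf μ v + xf μ w) := by
  ext i
  simp [xf, smul_dotProduct, add_dotProduct, mul_add]

lemma yf_midpoint (v w : Fin N → ℝ) :
    yf S ((1 / 2 : ℝ) • (v + w))
      = (1 / 2 : ℝ) • (yf S v + yf S w) - (1 / 4 : ℝ) • yf S (w - v) := by
  ext j
  simp only [yf, dotProduct_mulVec_midpoint, Pi.sub_apply, Pi.smul_apply, Pi.add_apply,
    smul_eq_mul]
  ring

lemma gvec_midpoint (a : Fin p → ℝ) (b : Fin q → ℝ) (v w : Fin N → ℝ) :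
    gvec μ S a b ((1 / 2 : ℝ) • (v + w))
      = (1 / 2 : ℝ) • (gvec μ S a b v + gvec μ S a b w)
        - (1 / 4 : ℝ) • Sum.elim (0 : Fin p → ℝ) (yf S (w - v)) := by
  ext t
  rcases t with i | j
  · simp only [gvec, xf_midpoint, Sum.elim_inl, Pi.sub_apply, Pi.smul_apply,
      Pi.add_apply, Pi.zero_apply, smul_eq_mul]
    ring
  · simp only [gvec, yf_midpoint, Sum.elim_inr, Pi.sub_apply, Pi.smul_apply,
      Pi.add_apply, smul_eq_mul]
    ring

lemma contDiff_gvec (a : Fin p → ℝ) (b : Fin q → ℝ) : ContDiff ℝ 1 (gvec μ S a b) := by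
  rw [contDiff_pi]
  rintro (i | j)
  · simp only [gvec, Sum.elim_inl, xf, dotProduct]
    fun_prop
  · simp only [gvec, Sum.elim_inr, yf, dotProduct, mulVec]
    fun_prop

variable (Fx : (Fin p → ℝ) → (Fin q → ℝ) → Fin p → ℝ) (Fy : (Fin p → ℝ) → (Fin q → ℝ) → Fin q → ℝ)

lemma continuous_ftilde (wk : Fin N → ℝ) : Continuous (ftilde μ S Fx Fy wk) := by
  unfold ftilde xf yf
  simp only [dotProduct, mulVec]
  fun_prop

lemma Lagr_midpoint (a : Fin p → ℝ) (b : Fin q → ℝ) (wk v w : Fin N → ℝ)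
    (η : Fin p ⊕ Fin q → ℝ) :
    Lagr μ S Fx Fy a b wk ((1 / 2 : ℝ) • (v + w)) η
      = (Lagr μ S Fx Fy a b wk v η + Lagr μ S Fx Fy a b wk w η) / 2
        - (Fy (xf μ wk) (yf S wk) ⬝ᵥ yf S (w - v)
          + η ⬝ᵥ Sum.elim (0 : Fin p → ℝ) (yf S (w - v))) / 4 := by
  simp only [Lagr, ftilde, gvec_midpoint, xf_midpoint, yf_midpoint, dotProduct_sub,
    dotProduct_smul, dotProduct_add, smul_eq_mul]
  ring

/-- The Lagrangian grows quadratically around its minimizer over the simplex, uniformly in the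
multiplier. -/
lemma exists_Lagr_growth (hS : ∀ j, (S j).PosDef) (a : Fin p → ℝ) (b : Fin q → ℝ)
    (wk : Fin N → ℝ) (hFy : ∀ j, 0 ≤ Fy (xf μ wk) (yf S wk) j)
    (hFy' : ∃ j, 0 < Fy (xf μ wk) (yf S wk) j) :
    ∃ c, 0 < c ∧ ∀ η : Fin p ⊕ Fin q → ℝ, 0 ≤ η → ∀ v ∈ simplex N,
      (∀ w ∈ simplex N, Lagr μ S Fx Fy a b wk v η ≤ Lagr μ S Fx Fy a b wk w η) →
      ∀ w ∈ simplex N,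
        Lagr μ S Fx Fy a b wk v η + c * ‖w - v‖ ^ 2 ≤ Lagr μ S Fx Fy a b wk w η := by
  obtain ⟨j, hj⟩ := hFy'
  obtain ⟨c, hc, hcS⟩ := exists_mul_norm_sq_le_dotProduct_mulVec (hS j)
  refine ⟨Fy (xf μ wk) (yf S wk) j * c / 2, by positivity, fun η hη v hv hmin w hw => ?_⟩
  have hyf : ∀ i, 0 ≤ yf S (w - v) i := fun i => by
    simpa [yf] using (hS i).posSemidef.dotProduct_mulVec_nonneg (w - v)
  have h1 := hmin _ (midpoint_mem_simplex hv hw)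
  rw [Lagr_midpoint] at h1
  have h2 : Fy (xf μ wk) (yf S wk) j * yf S (w - v) j
      ≤ Fy (xf μ wk) (yf S wk) ⬝ᵥ yf S (w - v) :=
    Finset.single_le_sum (f := fun i => Fy (xf μ wk) (yf S wk) i * yf S (w - v) i)
      (fun i _ => mul_nonneg (hFy i) (hyf i)) (Finset.mem_univ j)
  have h3 : 0 ≤ η ⬝ᵥ Sum.elim (0 : Fin p → ℝ) (yf S (w - v)) := by
    refine Finset.sum_nonneg fun t _ => mul_nonneg (hη t) ?_
    rcases t with i | i
    · simp
    · exact hyf i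
  have h4 := mul_le_mul_of_nonneg_left (hcS (w - v)) hj.le
  change _ ≤ _ * yf S (w - v) j at h4
  linarith

lemma mem_Kset_iff (a : Fin p → ℝ) (b : Fin q → ℝ) (w : Fin N → ℝ) :
    w ∈ Kset μ S a b ↔ w ∈ {w ∈ simplex N | ∀ t, gvec μ S a b w t ≤ 0} := by
  simp [Kset, gvec, Sum.forall]

end Midpoint

theorem inner_loop_convergence
    (N p q : ℕ)
    (μ : Fin p → Fin N → ℝ) (S : Fin q → Matrix (Fin N) (Fin N) ℝ)
    (hS : ∀ j, (S j).PosDef)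
    (F : (Fin p → ℝ) → (Fin q → ℝ) → ℝ)
    (Fx : (Fin p → ℝ) → (Fin q → ℝ) → Fin p → ℝ)
    (Fy : (Fin p → ℝ) → (Fin q → ℝ) → Fin q → ℝ)
    -- F is continuously differentiable with partial gradients Fx and Fy
    (hFsmooth : ContDiff ℝ 1 (fun z : (Fin p → ℝ) × (Fin q → ℝ) => F z.1 z.2))
    (hFderiv : ∀ z : (Fin p → ℝ) × (Fin q → ℝ),
      ∃ L : ((Fin p → ℝ) × (Fin q → ℝ)) →L[ℝ] ℝ,
        (∀ v : (Fin p → ℝ) × (Fin q → ℝ), L v = Fx z.1 z.2 ⬝ᵥ v.1 + Fy z.1 z.2 ⬝ᵥ v.2) ∧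
        HasFDerivAt (fun z : (Fin p → ℝ) × (Fin q → ℝ) => F z.1 z.2) L z)
    -- Assumption 1
    (hA1x : ∀ i, (∃ x y, Fx x y i ≠ 0) → ∀ x y, Fx x y i < 0)
    (hA1y : ∀ j, (∃ x y, Fy x y j ≠ 0) → ∀ x y, 0 < Fy x y j)
    (a : Fin p → ℝ) (b : Fin q → ℝ)
    -- K contains a strictly feasible point
    (hstrict : ∃ w ∈ simplex N, (∀ i, a i < xf μ w i) ∧ (∀ j, yf S w j < b j))
    -- Assumption 3: some y_j exists in F, and f has a Lipschitz continuous gradient on K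
    (hA3 : ∃ j x y, Fy x y j ≠ 0)
    (hLip : ∃ Lc : NNReal, LipschitzOnWith Lc (gradf μ S Fx Fy) (Kset μ S a b))
    -- fix w^k ∈ K (the weights λ^k = (−∇_xF, ∇_yF)(x(w^k),y(w^k)) enter through f̃ and L)
    (wk : Fin N → ℝ) (hwk : wk ∈ Kset μ S a b)
    -- ŵ(λ^k, η): the unique minimizer over W of the partial Lagrangian L(·, η)
    (what : (Fin p ⊕ Fin q → ℝ) → Fin N → ℝ)
    (hwhat : ∀ η : Fin p ⊕ Fin q → ℝ, 0 ≤ η →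
      what η ∈ simplex N ∧
      (∀ w ∈ simplex N, Lagr μ S Fx Fy a b wk (what η) η ≤ Lagr μ S Fx Fy a b wk w η) ∧
      (∀ w ∈ simplex N,
        Lagr μ S Fx Fy a b wk w η = Lagr μ S Fx Fy a b wk (what η) η → w = what η))
    -- Armijo parameters
    (αinit σ βr : ℝ) (hαinit : 0 < αinit)
    (hσ : σ ∈ Set.Ioo (0 : ℝ) 1) (hβr : βr ∈ Set.Ioo (0 : ℝ) 1)
    -- the dual sequence η^l and step sizes α^l
    (ηs : ℕ → Fin p ⊕ Fin q → ℝ) (αs : ℕ → ℝ)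
    (hη0 : 0 ≤ ηs 0)
    -- update η^{l+1} = [η^l + α^l g(ŵ(λ^k, η^l))]_+
    (hupd : ∀ l, ηs (l + 1) = etaCand (gvec μ S a b (what (ηs l))) (ηs l) (αs l))
    -- α^l is the largest element of {α_init β^j} satisfying the Armijo condition
    -- h(η^{l+1}) − h(η^l) ≥ σ g(ŵ(λ^k, η^l))ᵀ(η^{l+1} − η^l), where h(η) = L(ŵ(λ^k,η), η)
    (hArmijo : ∀ l, ∃ j : ℕ, αs l = αinit * βr ^ j ∧
      (σ * (gvec μ S a b (what (ηs l)) ⬝ᵥ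
            (etaCand (gvec μ S a b (what (ηs l))) (ηs l) (αs l) - ηs l)) ≤
        Lagr μ S Fx Fy a b wk
            (what (etaCand (gvec μ S a b (what (ηs l))) (ηs l) (αs l)))
            (etaCand (gvec μ S a b (what (ηs l))) (ηs l) (αs l))
          - Lagr μ S Fx Fy a b wk (what (ηs l)) (ηs l)) ∧
      (∀ j' < j, ¬ (σ * (gvec μ S a b (what (ηs l)) ⬝ᵥ
            (etaCand (gvec μ S a b (what (ηs l))) (ηs l) (αinit * βr ^ j') - ηs l)) ≤
        Lagr μ S Fx Fy a b wk
            (what (etaCand (gvec μ S a b (what (ηs l))) (ηs l) (αinit * βr ^ j')))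
            (etaCand (gvec μ S a b (what (ηs l))) (ηs l) (αinit * βr ^ j'))
          - Lagr μ S Fx Fy a b wk (what (ηs l)) (ηs l)))) :
    -- the primal sequence ŵ(λ^k, η^l) converges to the optimal solution of
    -- minimize_{w∈K} f̃(w; w^k)
    ∃ wopt ∈ Kset μ S a b,
      (∀ w ∈ Kset μ S a b, ftilde μ S Fx Fy wk wopt ≤ ftilde μ S Fx Fy wk w) ∧
      Tendsto (fun l => what (ηs l)) atTop (nhds wopt) := by
  have hFy : ∀ j, 0 ≤ Fy (xf μ wk) (yf S wk) j := fun j => by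
    by_cases hj : ∃ x y, Fy x y j ≠ 0
    · exact (hA1y j hj _ _).le
    · push Not at hj
      exact (hj _ _).ge
  obtain ⟨j₀, hj₀⟩ := hA3
  obtain ⟨c, hc, hgrow⟩ :=
    exists_Lagr_growth μ S Fx Fy hS a b wk hFy ⟨j₀, hA1y j₀ hj₀ _ _⟩
  have hg := contDiff_gvec μ S a b
  obtain ⟨K, hK⟩ := hg.contDiffOn.exists_lipschitzOnWith one_ne_zero
    (convex_stdSimplex ℝ (Fin N)) (isCompact_simplex N)
  have hset : Kset μ S a b = {w ∈ simplex N | ∀ t, gvec μ S a b w t ≤ 0} :=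
    Set.ext (mem_Kset_iff μ S a b)
  rw [hset]
  refine tendsto_of_armijo_dual_ascent (isCompact_simplex N) (continuous_ftilde μ S Fx Fy wk)
    hg.continuous hK hc (fun η hη => (hwhat η hη).1)
    (fun η hη => hgrow η hη _ (hwhat η hη).1 (hwhat η hη).2.1) ?_ hαinit hσ hβr
    (h := fun η => Lagr μ S Fx Fy a b wk (what η) η) (fun _ => rfl)
    (step := fun η s => etaCand (gvec μ S a b (what η)) η s) (fun _ _ _ => rfl)
    hη0 hupd hArmijo
  obtain ⟨w, hw, hx, hy⟩ := hstrict
  refine ⟨w, hw, ?_⟩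
  rintro (i | j)
  · exact sub_neg.mpr (hx i)
  · exact sub_neg.mpr (hy j)
end
end

section
/- (Proposition 2, convergence of SCQP.) Suppose Assumptions 1 and 3 hold. Let {γ^k} ⊂ (0, 1] satisfy γ^k → 0 and Σ_k γ^k = +∞. Starting from w^0 ∈ K, at each iteration let ŵ^k be the (unique) optimal solution of minimize_{w∈K} f̃(w; w^k), and set w^{k+1} = w^k + γ^k(ŵ^k − w^k). Then either the algorithm converges in a finite number of iterations to a stationary solution of (P), or every limit point of the sequence {w^k}_{k=1}^∞ (at least one such point exists) is a stationary solution of (P). -/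
/- STATEMENT 2 (Proposition 2, convergence of SCQP): under Assumptions 1 and 3, with
γ^k ∈ (0,1], γ^k → 0, Σ_k γ^k = +∞, ŵ^k the unique optimal solution of
minimize_{w∈K} f̃(w; w^k), and w^{k+1} = w^k + γ^k(ŵ^k − w^k) starting from w^0 ∈ K,
either the algorithm reaches a stationary solution of (P) in finitely many iterations,
or every limit point of {w^k} (at least one exists) is a stationary solution of (P). -/

noncomputable section
open Matrix Filter

/-- A descent sequence whose decrements dominate a non-summable step sequence times a gap `V`
cannot accumulate at a point near which the gap is bounded away from zero. -/
theorem not_mapClusterPt_of_descent {E : Type*} [PseudoMetricSpace E] {w : ℕ → E} {φ γ V : ℕ → ℝ}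
    {D ε δ : ℝ} {k₀ : ℕ} {x : E} (hγ : ∀ k, 0 ≤ γ k) (hV : ∀ k, 0 ≤ V k)
    (hγsum : Tendsto (fun n => ∑ k ∈ Finset.range n, γ k) atTop atTop)
    (hD : 0 < D) (hstep : ∀ k, dist (w (k + 1)) (w k) ≤ D * γ k)
    (hdesc : ∀ k, k₀ ≤ k → φ (k + 1) ≤ φ k - γ k * V k)
    (hbdd : BddBelow (Set.range φ)) (hε : 0 < ε) (hδ : 0 < δ)
    (hgap : ∀ k, dist (w k) x < δ → ε ≤ V k) : ¬ MapClusterPt x atTop w := by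
  intro hx
  set T : ℕ → ℝ := fun n => ∑ k ∈ Finset.range n, γ k
  have hT : ∀ n, T (n + 1) = T n + γ n := fun n => Finset.sum_range_succ _ _
  set ψ : ℕ → ℝ := fun n => φ (n + k₀)
  have hψbdd : BddBelow (Set.range ψ) := hbdd.mono (by rintro _ ⟨n, rfl⟩; exact ⟨_, rfl⟩)
  have hanti : Antitone ψ := antitone_nat_of_succ_le fun n => by
    have := hdesc (n + k₀) (by omega)
    have h2 := mul_nonneg (hγ (n + k₀)) (hV (n + k₀))
    simp only [ψ, Nat.add_right_comm n 1 k₀]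
    linarith
  have hη : 0 < ε * δ / (4 * D) := by positivity
  obtain ⟨n₀, hn₀⟩ := exists_lt_of_ciInf_lt (lt_add_of_pos_right (⨅ n, ψ n) hη)
  have hdrop : ∀ m n, n₀ + k₀ ≤ m → n₀ + k₀ ≤ n → φ m - φ n ≤ ε * δ / (4 * D) := by
    intro m n hm hn
    have h1 : ψ (m - k₀) ≤ ψ n₀ := hanti (by omega)
    have h2 : (⨅ n, ψ n) ≤ ψ (n - k₀) := ciInf_le hψbdd _
    simp only [ψ, Nat.sub_add_cancel (show k₀ ≤ m by omega)] at h1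
    simp only [ψ, Nat.sub_add_cancel (show k₀ ≤ n by omega)] at h2
    simp only [ψ] at hn₀
    linarith
  obtain ⟨m, hm, hmx⟩ := (mapClusterPt_iff_frequently.1 hx _
    (Metric.ball_mem_nhds x (half_pos hδ))).forall_exists_of_atTop (n₀ + k₀)
  rw [Metric.mem_ball] at hmx
  have key : ∀ j, dist (w (m + j)) (w m) ≤ D * (T (m + j) - T m) ∧
      ε * (T (m + j) - T m) ≤ φ m - φ (m + j) := by
    intro j
    induction j with
    | zero => simp
    | succ j ih =>
      obtain ⟨h1, h2⟩ := ih
      have h3 : T (m + j) - T m ≤ δ / (4 * D) := by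
        have := h2.trans (hdrop m (m + j) hm (by omega))
        rw [mul_div_assoc] at this
        exact le_of_mul_le_mul_left this hε
      have h4 : D * (T (m + j) - T m) ≤ δ / 4 := by
        calc D * (T (m + j) - T m) ≤ D * (δ / (4 * D)) := by gcongr
          _ = δ / 4 := by field_simp
      have h5 : ε ≤ V (m + j) := hgap _ (by linarith [dist_triangle (w (m + j)) (w m) x])
      have h6 := mul_le_mul_of_nonneg_left h5 (hγ (m + j))
      have h7 := hdesc (m + j) (by omega)
      have h8 := hstep (m + j)
      have h9 := dist_triangle (w (m + j + 1)) (w (m + j)) (w m)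
      rw [← add_assoc, hT]
      constructor <;> nlinarith
  obtain ⟨n, hn⟩ := ((tendsto_atTop.1 hγsum (T m + δ / (4 * D) + 1)).and
    (eventually_ge_atTop m)).exists
  obtain ⟨j, rfl⟩ := Nat.exists_eq_add_of_le hn.2
  have h := (key j).2.trans (hdrop m (m + j) hm (by omega))
  rw [mul_div_assoc] at h
  have h1 := le_of_mul_le_mul_left h hε
  have h2 : T m + δ / (4 * D) + 1 ≤ T (m + j) := hn.1
  linarith

/-- The descent lemma along a line. -/
theorem le_add_mul_add_sq_of_hasDerivAt {φ φ' : ℝ → ℝ} {M s : ℝ} (hs : 0 < s) (hM : 0 ≤ M)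
    (hφ : ∀ t, HasDerivAt φ (φ' t) t) (hφ' : ∀ t, 0 < t → t < s → φ' t ≤ φ' 0 + M * t) :
    φ s ≤ φ 0 + s * φ' 0 + M * s ^ 2 := by
  obtain ⟨t, ⟨ht0, hts⟩, ht⟩ := exists_hasDerivAt_eq_slope φ φ' hs
    (fun t _ => (hφ t).continuousAt.continuousWithinAt) (fun t _ => hφ t)
  rw [sub_zero, eq_div_iff hs.ne'] at ht
  have h1 : φ' t ≤ φ' 0 + M * s :=
    (hφ' t ht0 hts).trans (by gcongr)
  have h2 := mul_le_mul_of_nonneg_right h1 hs.le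
  nlinarith

theorem abs_dotProduct_le {n : ℕ} (u v : Fin n → ℝ) : |u ⬝ᵥ v| ≤ n * (‖u‖ * ‖v‖) := by
  calc |u ⬝ᵥ v| ≤ ∑ i, |u i * v i| := Finset.abs_sum_le_sum_abs _ _
    _ ≤ ∑ _i : Fin n, ‖u‖ * ‖v‖ := Finset.sum_le_sum fun i _ => by
        rw [abs_mul]
        exact mul_le_mul (norm_le_pi_norm u i) (norm_le_pi_norm v i) (abs_nonneg _) (norm_nonneg _)
    _ = n * (‖u‖ * ‖v‖) := by simp

theorem Matrix.PosDef.exists_mul_norm_sq_le {n : ℕ} {A : Matrix (Fin n) (Fin n) ℝ}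
    (hA : A.PosDef) : ∃ c, 0 < c ∧ ∀ d : Fin n → ℝ, c * ‖d‖ ^ 2 ≤ d ⬝ᵥ A.mulVec d := by
  have hcont : Continuous fun d : Fin n → ℝ => d ⬝ᵥ A.mulVec d := by fun_prop
  obtain ⟨c, hc, hmin⟩ := (isCompact_sphere (0 : Fin n → ℝ) 1).exists_forall_le'
    hcont.continuousOn (a := 0) (fun d hd => by
      have : d ≠ 0 := by rintro rfl; simp at hd
      simpa using hA.dotProduct_mulVec_pos this)
  refine ⟨c, hc, fun d => ?_⟩
  rcases eq_or_ne d 0 with rfl | hd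
  · simp
  have hd' : ‖d‖ ≠ 0 := norm_ne_zero_iff.2 hd
  have h := hmin (‖d‖⁻¹ • d) (by simp [norm_smul, hd'])
  simp only [mulVec_smul, dotProduct_smul, smul_dotProduct, smul_eq_mul] at h
  have := mul_le_mul_of_nonneg_right h (sq_nonneg ‖d‖)
  calc c * ‖d‖ ^ 2 ≤ _ := this
    _ = d ⬝ᵥ A.mulVec d := by field_simp

theorem xf_add_smul {N p : ℕ} (μ : Fin p → Fin N → ℝ) (w d : Fin N → ℝ) (t : ℝ) :
    xf μ (w + t • d) = xf μ w + t • xf μ d := by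
  ext i
  simp [xf, add_dotProduct]

theorem yf_add_smul {N q : ℕ} {S : Fin q → Matrix (Fin N) (Fin N) ℝ} (hS : ∀ j, (S j).PosDef)
    (w d : Fin N → ℝ) (t : ℝ) :
    yf S (w + t • d) =
      yf S w + t • (fun j => 2 * d ⬝ᵥ (S j).mulVec w) + t ^ 2 • yf S d := by
  ext j
  have hsymm : w ⬝ᵥ (S j).mulVec d = d ⬝ᵥ (S j).mulVec w := by
    have hT : (S j)ᵀ = S j := by simpa using (hS j).1.eq
    rw [dotProduct_mulVec, dotProduct_comm, ← mulVec_transpose, hT]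
  simp only [yf, mulVec_add, mulVec_smul, add_dotProduct, dotProduct_add, smul_dotProduct,
    dotProduct_smul, smul_eq_mul, Pi.add_apply, Pi.smul_apply, hsymm]
  ring

theorem yf_nonneg {N q : ℕ} {S : Fin q → Matrix (Fin N) (Fin N) ℝ} (hS : ∀ j, (S j).PosDef)
    (d : Fin N → ℝ) (j : Fin q) : 0 ≤ yf S d j := by
  simpa [yf] using (hS j).posSemidef.dotProduct_mulVec_nonneg d

theorem dotProduct_gradf {N p q : ℕ} (μ : Fin p → Fin N → ℝ)
    (S : Fin q → Matrix (Fin N) (Fin N) ℝ)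
    (Fx : (Fin p → ℝ) → (Fin q → ℝ) → Fin p → ℝ) (Fy : (Fin p → ℝ) → (Fin q → ℝ) → Fin q → ℝ)
    (w d : Fin N → ℝ) :
    d ⬝ᵥ gradf μ S Fx Fy w = Fx (xf μ w) (yf S w) ⬝ᵥ xf μ d +
      Fy (xf μ w) (yf S w) ⬝ᵥ fun j => 2 * d ⬝ᵥ (S j).mulVec w := by
  have : gradf μ S Fx Fy w = ∑ i, Fx (xf μ w) (yf S w) i • μ i
      + ∑ j, (2 * Fy (xf μ w) (yf S w) j) • (S j).mulVec w := by
    ext n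
    simp [gradf]
  rw [this, dotProduct_add, dotProduct_sum, dotProduct_sum]
  simp only [dotProduct_smul, smul_eq_mul]
  congr 1
  exact Finset.sum_congr rfl fun j _ => by ring

/-- Exact second-order expansion of the surrogate at its base point. -/
theorem ftilde_add_smul {N p q : ℕ} (μ : Fin p → Fin N → ℝ)
    {S : Fin q → Matrix (Fin N) (Fin N) ℝ} (hS : ∀ j, (S j).PosDef)
    (Fx : (Fin p → ℝ) → (Fin q → ℝ) → Fin p → ℝ) (Fy : (Fin p → ℝ) → (Fin q → ℝ) → Fin q → ℝ)
    (w d : Fin N → ℝ) (t : ℝ) :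
    ftilde μ S Fx Fy w (w + t • d) = ftilde μ S Fx Fy w w + t * (d ⬝ᵥ gradf μ S Fx Fy w)
      + t ^ 2 * (Fy (xf μ w) (yf S w) ⬝ᵥ yf S d) := by
  rw [dotProduct_gradf, ftilde, ftilde, xf_add_smul, yf_add_smul hS]
  simp only [dotProduct_add, dotProduct_smul, smul_eq_mul]
  ring

theorem continuous_xf {N p : ℕ} (μ : Fin p → Fin N → ℝ) : Continuous (xf μ) :=
  continuous_pi fun i => by unfold xf; fun_prop

theorem continuous_yf {N q : ℕ} (S : Fin q → Matrix (Fin N) (Fin N) ℝ) : Continuous (yf S) :=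
  continuous_pi fun j => by unfold yf; fun_prop

theorem add_smul_sub_mem_Kset {N p q : ℕ} (μ : Fin p → Fin N → ℝ)
    {S : Fin q → Matrix (Fin N) (Fin N) ℝ} (hS : ∀ j, (S j).PosDef)
    (a : Fin p → ℝ) (b : Fin q → ℝ) {w z : Fin N → ℝ} (hw : w ∈ Kset μ S a b)
    (hz : z ∈ Kset μ S a b) {t : ℝ} (ht0 : 0 ≤ t) (ht1 : t ≤ 1) :
    w + t • (z - w) ∈ Kset μ S a b := by
  obtain ⟨⟨hw0, hw1⟩, hwx, hwy⟩ := hw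
  obtain ⟨⟨hz0, hz1⟩, hzx, hzy⟩ := hz
  have ht1' : 0 ≤ 1 - t := by linarith
  refine ⟨⟨fun i => ?_, ?_⟩, fun i => ?_, fun j => ?_⟩
  · have h1 := mul_nonneg ht0 (hz0 i)
    have h2 := mul_nonneg ht1' (hw0 i)
    simp only [Pi.add_apply, Pi.smul_apply, Pi.sub_apply, smul_eq_mul]
    linarith
  · simp [Finset.sum_add_distrib, ← Finset.mul_sum, hw1, hz1]
  · have h := congrFun (xf_add_smul μ w (z - w) 1) i
    rw [xf_add_smul]
    simp only [one_smul, add_sub_cancel, Pi.add_apply, Pi.smul_apply, smul_eq_mul] at h ⊢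
    have h1 := mul_le_mul_of_nonneg_left (hzx i) ht0
    have h2 := mul_le_mul_of_nonneg_left (hwx i) ht1'
    nlinarith
  · have h := congrFun (yf_add_smul hS w (z - w) 1) j
    rw [yf_add_smul hS]
    simp only [one_smul, one_pow, add_sub_cancel, Pi.add_apply, Pi.smul_apply, smul_eq_mul] at h ⊢
    have h1 := mul_le_mul_of_nonneg_left (hzy j) ht0
    have h2 := mul_le_mul_of_nonneg_left (hwy j) ht1'
    have h3 := mul_nonneg (mul_nonneg ht0 ht1') (yf_nonneg hS (z - w) j)
    nlinarith

theorem isCompact_Kset {N p q : ℕ} (μ : Fin p → Fin N → ℝ)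
    (S : Fin q → Matrix (Fin N) (Fin N) ℝ) (a : Fin p → ℝ) (b : Fin q → ℝ) :
    IsCompact (Kset μ S a b) := by
  have hx := continuous_xf μ
  have hy := continuous_yf S
  refine (isCompact_Icc (a := (0 : Fin N → ℝ)) (b := 1)).of_isClosed_subset ?_ ?_
  · simp only [Kset, simplex, Set.ofPred_and, Set.ofPred_forall]
    refine ((isClosed_iInter fun i => isClosed_le (by fun_prop) (by fun_prop)).inter
      (isClosed_eq (by fun_prop) (by fun_prop))).inter
      ((isClosed_iInter fun i => isClosed_le (by fun_prop) (by fun_prop)).inter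
        (isClosed_iInter fun j => isClosed_le (by fun_prop) (by fun_prop)))
  · rintro w ⟨⟨hw0, hw1⟩, -⟩
    exact ⟨hw0, fun i =>
      (Finset.single_le_sum (fun j _ => hw0 j) (Finset.mem_univ i)).trans hw1.le⟩

theorem norm_sub_le_one_of_mem_Kset {N p q : ℕ} {μ : Fin p → Fin N → ℝ}
    {S : Fin q → Matrix (Fin N) (Fin N) ℝ} {a : Fin p → ℝ} {b : Fin q → ℝ} {w z : Fin N → ℝ}
    (hw : w ∈ Kset μ S a b) (hz : z ∈ Kset μ S a b) : ‖z - w‖ ≤ 1 := by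
  have hle : ∀ {v}, v ∈ Kset μ S a b → ∀ i, v i ≤ 1 := fun hv i =>
    hv.1.2 ▸ Finset.single_le_sum (fun j _ => hv.1.1 j) (Finset.mem_univ i)
  refine (pi_norm_le_iff_of_nonneg zero_le_one).2 fun i => ?_
  rw [Real.norm_eq_abs, Pi.sub_apply, abs_le]
  constructor <;> linarith [hw.1.1 i, hz.1.1 i, hle hw i, hle hz i]

/-- The chain rule for `f = F ∘ (x, y)` along a line. -/
theorem hasDerivAt_comp_line {N p q : ℕ} {μ : Fin p → Fin N → ℝ}
    {S : Fin q → Matrix (Fin N) (Fin N) ℝ} (hS : ∀ j, (S j).PosDef)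
    {F : (Fin p → ℝ) → (Fin q → ℝ) → ℝ}
    {Fx : (Fin p → ℝ) → (Fin q → ℝ) → Fin p → ℝ} {Fy : (Fin p → ℝ) → (Fin q → ℝ) → Fin q → ℝ}
    (hF : ∀ z : (Fin p → ℝ) × (Fin q → ℝ),
      ∃ L : ((Fin p → ℝ) × (Fin q → ℝ)) →L[ℝ] ℝ,
        (∀ v : (Fin p → ℝ) × (Fin q → ℝ), L v = Fx z.1 z.2 ⬝ᵥ v.1 + Fy z.1 z.2 ⬝ᵥ v.2) ∧
        HasFDerivAt (fun z : (Fin p → ℝ) × (Fin q → ℝ) => F z.1 z.2) L z)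
    (w d : Fin N → ℝ) (t : ℝ) :
    HasDerivAt (fun s : ℝ => F (xf μ (w + s • d)) (yf S (w + s • d)))
      (d ⬝ᵥ gradf μ S Fx Fy (w + t • d)) t := by
  obtain ⟨L, hL, hLd⟩ := hF (xf μ (w + t • d), yf S (w + t • d))
  have hx : HasDerivAt (fun s : ℝ => xf μ (w + s • d)) (xf μ d) t := by
    simp only [xf_add_smul]
    simpa using ((hasDerivAt_id t).smul_const (xf μ d)).const_add (xf μ w)
  have hy : HasDerivAt (fun s : ℝ => yf S (w + s • d))
      (fun j => 2 * d ⬝ᵥ (S j).mulVec (w + t • d)) t := by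
    simp only [yf_add_smul hS]
    refine ((((hasDerivAt_id t).smul_const (fun j => 2 * d ⬝ᵥ (S j).mulVec w)).const_add
      (yf S w)).add ((hasDerivAt_pow 2 t).smul_const (yf S d))).congr_deriv ?_
    ext j
    simp [yf, mulVec_add, mulVec_smul]
    ring
  have h := hLd.comp_hasDerivAt t (hx.prodMk hy)
  rwa [hL, ← dotProduct_gradf] at h

theorem continuous_partial_gradients {p q : ℕ} {F : (Fin p → ℝ) → (Fin q → ℝ) → ℝ}
    {Fx : (Fin p → ℝ) → (Fin q → ℝ) → Fin p → ℝ} {Fy : (Fin p → ℝ) → (Fin q → ℝ) → Fin q → ℝ}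
    (hFsmooth : ContDiff ℝ 1 (fun z : (Fin p → ℝ) × (Fin q → ℝ) => F z.1 z.2))
    (hF : ∀ z : (Fin p → ℝ) × (Fin q → ℝ),
      ∃ L : ((Fin p → ℝ) × (Fin q → ℝ)) →L[ℝ] ℝ,
        (∀ v : (Fin p → ℝ) × (Fin q → ℝ), L v = Fx z.1 z.2 ⬝ᵥ v.1 + Fy z.1 z.2 ⬝ᵥ v.2) ∧
        HasFDerivAt (fun z : (Fin p → ℝ) × (Fin q → ℝ) => F z.1 z.2) L z) :
    Continuous (fun z : (Fin p → ℝ) × (Fin q → ℝ) => Fx z.1 z.2) ∧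
      Continuous (fun z : (Fin p → ℝ) × (Fin q → ℝ) => Fy z.1 z.2) := by
  have hc := hFsmooth.continuous_fderiv one_ne_zero
  have hv : ∀ z v : (Fin p → ℝ) × (Fin q → ℝ),
      fderiv ℝ (fun z : (Fin p → ℝ) × (Fin q → ℝ) => F z.1 z.2) z v =
        Fx z.1 z.2 ⬝ᵥ v.1 + Fy z.1 z.2 ⬝ᵥ v.2 := by
    intro z v
    obtain ⟨L, hL, hLd⟩ := hF z
    rw [hLd.fderiv, hL]
  refine ⟨continuous_pi fun i => ?_, continuous_pi fun j => ?_⟩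
  · refine (hc.clm_apply (continuous_const (y := (Pi.single i 1, 0)))).congr fun z => ?_
    simp [hv]
  · refine (hc.clm_apply (continuous_const (y := (0, Pi.single j 1)))).congr fun z => ?_
    simp [hv]

/-- Under the sign conditions on `∂F/∂y`, the curvature of the surrogate is bounded below
uniformly over the base points in a compact set. -/
theorem exists_curvature_bound {N p q : ℕ} {μ : Fin p → Fin N → ℝ}
    {S : Fin q → Matrix (Fin N) (Fin N) ℝ} (hS : ∀ j, (S j).PosDef)
    {Fy : (Fin p → ℝ) → (Fin q → ℝ) → Fin q → ℝ}
    (hFy : Continuous fun z : (Fin p → ℝ) × (Fin q → ℝ) => Fy z.1 z.2)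
    (hA1y : ∀ j, (∃ x y, Fy x y j ≠ 0) → ∀ x y, 0 < Fy x y j)
    (hA3 : ∃ j x y, Fy x y j ≠ 0) {K : Set (Fin N → ℝ)} (hK : IsCompact K) :
    ∃ c, 0 < c ∧ ∀ w ∈ K, ∀ d, c * ‖d‖ ^ 2 ≤ Fy (xf μ w) (yf S w) ⬝ᵥ yf S d := by
  obtain ⟨j, hj⟩ := hA3
  have hcont : Continuous fun w => Fy (xf μ w) (yf S w) j :=
    (continuous_apply j).comp (hFy.comp ((continuous_xf μ).prodMk (continuous_yf S)))
  obtain ⟨c₁, hc₁, h₁⟩ := hK.exists_forall_le' hcont.continuousOn (a := 0)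
    fun w _ => hA1y j hj _ _
  obtain ⟨c₂, hc₂, h₂⟩ := (hS j).exists_mul_norm_sq_le
  refine ⟨c₁ * c₂, mul_pos hc₁ hc₂, fun w hw d => ?_⟩
  have hnonneg : ∀ i, 0 ≤ Fy (xf μ w) (yf S w) i := fun i => by
    by_cases h : ∃ x y, Fy x y i ≠ 0
    · exact (hA1y i h _ _).le
    · push Not at h
      exact (h _ _).ge
  calc c₁ * c₂ * ‖d‖ ^ 2 = c₁ * (c₂ * ‖d‖ ^ 2) := by ring
    _ ≤ Fy (xf μ w) (yf S w) j * yf S d j :=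
        mul_le_mul (h₁ w hw) (h₂ d) (by positivity) (hnonneg j)
    _ ≤ Fy (xf μ w) (yf S w) ⬝ᵥ yf S d :=
        Finset.single_le_sum (f := fun i => Fy (xf μ w) (yf S w) i * yf S d i)
          (fun i _ => mul_nonneg (hnonneg i) (yf_nonneg hS d i)) (Finset.mem_univ j)

theorem scqp_convergence
    (N p q : ℕ)
    (μ : Fin p → Fin N → ℝ) (S : Fin q → Matrix (Fin N) (Fin N) ℝ)
    (hS : ∀ j, (S j).PosDef)
    (F : (Fin p → ℝ) → (Fin q → ℝ) → ℝ)
    (Fx : (Fin p → ℝ) → (Fin q → ℝ) → Fin p → ℝ)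
    (Fy : (Fin p → ℝ) → (Fin q → ℝ) → Fin q → ℝ)
    -- F is continuously differentiable with partial gradients Fx and Fy
    (hFsmooth : ContDiff ℝ 1 (fun z : (Fin p → ℝ) × (Fin q → ℝ) => F z.1 z.2))
    (hFderiv : ∀ z : (Fin p → ℝ) × (Fin q → ℝ),
      ∃ L : ((Fin p → ℝ) × (Fin q → ℝ)) →L[ℝ] ℝ,
        (∀ v : (Fin p → ℝ) × (Fin q → ℝ), L v = Fx z.1 z.2 ⬝ᵥ v.1 + Fy z.1 z.2 ⬝ᵥ v.2) ∧
        HasFDerivAt (fun z : (Fin p → ℝ) × (Fin q → ℝ) => F z.1 z.2) L z)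
    -- Assumption 1
    (hA1x : ∀ i, (∃ x y, Fx x y i ≠ 0) → ∀ x y, Fx x y i < 0)
    (hA1y : ∀ j, (∃ x y, Fy x y j ≠ 0) → ∀ x y, 0 < Fy x y j)
    (a : Fin p → ℝ) (b : Fin q → ℝ)
    -- K contains a strictly feasible point
    (hstrict : ∃ w ∈ simplex N, (∀ i, a i < xf μ w i) ∧ (∀ j, yf S w j < b j))
    -- Assumption 3: some y_j exists in F, and f has a Lipschitz continuous gradient on K
    (hA3 : ∃ j x y, Fy x y j ≠ 0)
    (hLip : ∃ Lc : NNReal, LipschitzOnWith Lc (gradf μ S Fx Fy) (Kset μ S a b))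
    -- step sizes: γ^k ∈ (0,1], γ^k → 0, Σ γ^k = +∞
    (γ : ℕ → ℝ) (hγmem : ∀ k, γ k ∈ Set.Ioc (0 : ℝ) 1)
    (hγ0 : Tendsto γ atTop (nhds 0))
    (hγsum : Tendsto (fun n => ∑ k ∈ Finset.range n, γ k) atTop atTop)
    -- the SCQP iterates
    (w what : ℕ → Fin N → ℝ)
    (hw0 : w 0 ∈ Kset μ S a b)
    -- ŵ^k is the unique optimal solution of minimize_{z ∈ K} f̃(z; w^k)
    (hwhat : ∀ k, what k ∈ Kset μ S a b ∧
      (∀ z ∈ Kset μ S a b, ftilde μ S Fx Fy (w k) (what k) ≤ ftilde μ S Fx Fy (w k) z) ∧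
      (∀ z ∈ Kset μ S a b,
        ftilde μ S Fx Fy (w k) z = ftilde μ S Fx Fy (w k) (what k) → z = what k))
    -- update w^{k+1} = w^k + γ^k (ŵ^k − w^k)
    (hupd : ∀ k, w (k + 1) = w k + γ k • (what k - w k)) :
    -- either a stationary solution of (P) is reached in finitely many iterations ...
    (∃ k, w k ∈ Kset μ S a b ∧
        ∀ z ∈ Kset μ S a b, 0 ≤ (z - w k) ⬝ᵥ gradf μ S Fx Fy (w k)) ∨
    -- ... or at least one limit point exists and every limit point is stationary for (P)
    ((∃ wb, MapClusterPt wb atTop w) ∧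
      ∀ wb, MapClusterPt wb atTop w →
        wb ∈ Kset μ S a b ∧
        ∀ z ∈ Kset μ S a b, 0 ≤ (z - wb) ⬝ᵥ gradf μ S Fx Fy wb) := by
  right
  have hK := isCompact_Kset μ S a b
  have hwK : ∀ k, w k ∈ Kset μ S a b := fun k => by
    induction k with
    | zero => exact hw0
    | succ k ih =>
      rw [hupd]
      exact add_smul_sub_mem_Kset μ hS a b ih (hwhat k).1 (hγmem k).1.le (hγmem k).2
  obtain ⟨hFxc, hFyc⟩ := continuous_partial_gradients hFsmooth hFderiv
  obtain ⟨c, hc, hcurv⟩ := exists_curvature_bound (μ := μ) hS hFyc hA1y hA3 hK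
  obtain ⟨Lc, hLip⟩ := hLip
  have hxy : Continuous fun w => (xf μ w, yf S w) := (continuous_xf μ).prodMk (continuous_yf S)
  have hfcont : Continuous fun w => F (xf μ w) (yf S w) := hFsmooth.continuous.comp hxy
  have hFx' : Continuous fun w => Fx (xf μ w) (yf S w) := hFxc.comp hxy
  have hFy' : Continuous fun w => Fy (xf μ w) (yf S w) := hFyc.comp hxy
  set V : ℕ → ℝ := fun k =>
    ftilde μ S Fx Fy (w k) (w k) - ftilde μ S Fx Fy (w k) (what k) with hVdef
  have hV : ∀ k, 0 ≤ V k := fun k => sub_nonneg.2 ((hwhat k).2.1 _ (hwK k))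
  have hgrad : ∀ k, (what k - w k) ⬝ᵥ gradf μ S Fx Fy (w k) ≤ -V k - c * ‖what k - w k‖ ^ 2 := by
    intro k
    have h := ftilde_add_smul μ hS Fx Fy (w k) (what k - w k) 1
    rw [one_smul, add_sub_cancel] at h
    have := hcurv _ (hwK k) (what k - w k)
    simp only [hVdef]
    linarith
  have hdescent : ∀ k, F (xf μ (w (k + 1))) (yf S (w (k + 1))) ≤ F (xf μ (w k)) (yf S (w k)) +
      γ k * ((what k - w k) ⬝ᵥ gradf μ S Fx Fy (w k)) +
        N * Lc * ‖what k - w k‖ ^ 2 * γ k ^ 2 := by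
    intro k
    have h := le_add_mul_add_sq_of_hasDerivAt (hγmem k).1
      (M := N * Lc * ‖what k - w k‖ ^ 2) (by positivity)
      (hasDerivAt_comp_line hS hFderiv (w k) (what k - w k)) (by
        intro t ht hts
        have hmem := add_smul_sub_mem_Kset μ hS a b (hwK k) (hwhat k).1 ht.le (hts.le.trans (hγmem k).2)
        have h1 := hLip.dist_le_mul _ hmem _ (hwK k)
        rw [dist_eq_norm, dist_eq_norm, add_sub_cancel_left, norm_smul,
          Real.norm_of_nonneg ht.le] at h1
        have h2 := (le_abs_self _).trans (abs_dotProduct_le (what k - w k)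
          (gradf μ S Fx Fy (w k + t • (what k - w k)) - gradf μ S Fx Fy (w k)))
        rw [dotProduct_sub] at h2
        have h3 : (N : ℝ) * (‖what k - w k‖ *
            ‖gradf μ S Fx Fy (w k + t • (what k - w k)) - gradf μ S Fx Fy (w k)‖) ≤
            N * (‖what k - w k‖ * (Lc * (t * ‖what k - w k‖))) := by gcongr
        rw [zero_smul, add_zero]
        linarith)
    simpa only [zero_smul, add_zero, ← hupd k] using h
  have hγsmall : ∀ᶠ k in atTop, N * Lc * γ k ≤ c := by
    have : Tendsto (fun k => N * Lc * γ k) atTop (nhds 0) := by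
      simpa using hγ0.const_mul ((N : ℝ) * Lc)
    exact (this.eventually_lt_const hc).mono fun _ h => h.le
  obtain ⟨k₀, hk₀⟩ := eventually_atTop.1 hγsmall
  have hdec : ∀ k, k₀ ≤ k → F (xf μ (w (k + 1))) (yf S (w (k + 1))) ≤
      F (xf μ (w k)) (yf S (w k)) - γ k * V k := by
    intro k hk
    have h1 := mul_le_mul_of_nonneg_left (hgrad k) (hγmem k).1.le
    have h2 := mul_le_mul_of_nonneg_right (hk₀ k hk)
      (mul_nonneg (hγmem k).1.le (sq_nonneg ‖what k - w k‖))
    linarith [hdescent k]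
  have hbdd : BddBelow (Set.range fun k => F (xf μ (w k)) (yf S (w k))) :=
    (hK.bddBelow_image hfcont.continuousOn).mono
      (Set.range_subset_iff.2 fun k => Set.mem_image_of_mem _ (hwK k))
  have hstep : ∀ k, dist (w (k + 1)) (w k) ≤ 1 * γ k := by
    intro k
    rw [hupd, dist_eq_norm, add_sub_cancel_left, norm_smul, Real.norm_of_nonneg (hγmem k).1.le,
      mul_comm]
    exact mul_le_mul_of_nonneg_right (norm_sub_le_one_of_mem_Kset (hwK k) (hwhat k).1)
      (hγmem k).1.le
  refine ⟨?_, fun wb hwb => ?_⟩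
  · obtain ⟨wb, -, h⟩ := hK.exists_mapClusterPt (f := atTop) (u := w)
      (tendsto_principal.2 (Eventually.of_forall hwK))
    exact ⟨wb, h⟩
  have hwbK : wb ∈ Kset μ S a b :=
    hK.isClosed.mem_of_mapClusterPt hwb (Eventually.of_forall hwK)
  refine ⟨hwbK, fun z hz => ?_⟩
  by_contra! hneg
  obtain ⟨z', hz', hlt⟩ : ∃ z' ∈ Kset μ S a b,
      ftilde μ S Fx Fy wb z' < ftilde μ S Fx Fy wb wb := by
    set A := (z - wb) ⬝ᵥ gradf μ S Fx Fy wb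
    set B := Fy (xf μ wb) (yf S wb) ⬝ᵥ yf S (z - wb) with hB
    have hB0 : 0 ≤ B := le_trans (by positivity) (hcurv wb hwbK (z - wb))
    have hpos : 0 < B - A := by linarith
    have ht0 : 0 < -A / (B - A) := div_pos (by linarith) hpos
    refine ⟨wb + (-A / (B - A)) • (z - wb), add_smul_sub_mem_Kset μ hS a b hwbK hz ht0.le
      ((div_le_one hpos).2 (by linarith)), ?_⟩
    rw [ftilde_add_smul μ hS]
    have hmul : -A / (B - A) * (B - A) = -A := div_mul_cancel₀ _ hpos.ne'
    have : -A / (B - A) * (-A / (B - A) * A) < 0 :=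
      mul_neg_of_pos_of_neg ht0 (mul_neg_of_pos_of_neg ht0 hneg)
    nlinarith
  have hgapc : Continuous fun v => ftilde μ S Fx Fy v v - ftilde μ S Fx Fy v z' := by
    have hx := continuous_xf μ
    have hy := continuous_yf S
    unfold ftilde
    fun_prop
  obtain ⟨ε, hε, hεlt⟩ := exists_between (sub_pos.2 hlt)
  obtain ⟨δ, hδ, hball⟩ := Metric.eventually_nhds_iff.1
    (hgapc.continuousAt.eventually_const_lt hεlt)
  refine not_mapClusterPt_of_descent (fun k => (hγmem k).1.le) hV hγsum one_pos hstep hdec hbdd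
    hε hδ (fun k hk => ?_) hwb
  have h1 := hball hk
  have h2 := (hwhat k).2.1 z' hz'
  simp only [hVdef]
  linarith
end
end

section
/- (Proposition 3.) The sequence {w^k} generated by Algorithm 2 (the new active-set strategy) converges to the optimal solution of the quadratic program within |L̄^0 ∪ Ū^0| iterations; that is, there exists k ≤ |L̄^0 ∪ Ū^0| such that all multipliers β^l_i (i ∈ L̄^k) and β^u_i (i ∈ Ū^k) are nonnegative and w^k is the optimal solution of the original QP. -/
/- STATEMENT 3 (Proposition 3): the sequence {w^k} generated by Algorithm 2 (the new
active-set strategy) converges to the optimal solution of the QP within |L̄^0 ∪ Ū^0|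
iterations: there is k ≤ |L̄^0 ∪ Ū^0| at which all multipliers β^l_i (i ∈ L̄^k) and
β^u_i (i ∈ Ū^k) are nonnegative and w^k is the optimal solution of the original QP. -/

noncomputable section
open Matrix

variable {N M : ℕ}

/-- The QP objective `q(w) = cᵀw + (1/2) wᵀHw`. -/
def qobj (c : Fin N → ℝ) (H : Matrix (Fin N) (Fin N) ℝ) (w : Fin N → ℝ) : ℝ :=
  c ⬝ᵥ w + 1 / 2 * (w ⬝ᵥ H.mulVec w)

/-- Feasibility for the original QP: `Aw = b`, `l ≤ w ≤ u`. -/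
def feas (A : Matrix (Fin M) (Fin N) ℝ) (b : Fin M → ℝ) (l u : Fin N → ℝ)
    (w : Fin N → ℝ) : Prop :=
  A.mulVec w = b ∧ ∀ i, l i ≤ w i ∧ w i ≤ u i

/-- Feasibility for the restricted subproblem with working set `L ∪ U`:
additionally `w_i = l_i` for `i ∈ L` and `w_i = u_i` for `i ∈ U`. -/
def rfeas (A : Matrix (Fin M) (Fin N) ℝ) (b : Fin M → ℝ) (l u : Fin N → ℝ)
    (L U : Finset (Fin N)) (w : Fin N → ℝ) : Prop :=
  feas A b l u w ∧ (∀ i ∈ L, w i = l i) ∧ (∀ i ∈ U, w i = u i)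

/-- KKT multipliers for the restricted subproblem at `w`: `ν` for `Aw = b`,
nonnegative `γl, γu` with complementary slackness for the bounds of free indices,
and `βl, βu` for the frozen constraints, satisfying stationarity. -/
structure KKT (c : Fin N → ℝ) (H : Matrix (Fin N) (Fin N) ℝ)
    (A : Matrix (Fin M) (Fin N) ℝ) (b : Fin M → ℝ) (l u : Fin N → ℝ)
    (L U : Finset (Fin N)) (w : Fin N → ℝ)
    (ν : Fin M → ℝ) (γl γu βl βu : Fin N → ℝ) : Prop where
  γl_nonneg : ∀ i, i ∉ L ∪ U → 0 ≤ γl i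
  γu_nonneg : ∀ i, i ∉ L ∪ U → 0 ≤ γu i
  compl_l : ∀ i, i ∉ L ∪ U → γl i * (w i - l i) = 0
  compl_u : ∀ i, i ∉ L ∪ U → γu i * (u i - w i) = 0
  stationarity : ∀ j, c j + H.mulVec w j + Aᵀ.mulVec ν j
      - (if j ∈ L then βl j else 0) + (if j ∈ U then βu j else 0)
      - (if j ∉ L ∪ U then γl j - γu j else 0) = 0

/-- Second-order expansion of the objective around `w`. -/
lemma qobj_sub_qobj {c : Fin N → ℝ} {H : Matrix (Fin N) (Fin N) ℝ} (hH : H.IsSymm)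
    (w w' : Fin N → ℝ) :
    qobj c H w' - qobj c H w =
      (c + H *ᵥ w) ⬝ᵥ (w' - w) + 1 / 2 * ((w' - w) ⬝ᵥ H *ᵥ (w' - w)) := by
  have hsymm : w ⬝ᵥ H *ᵥ w' = w' ⬝ᵥ H *ᵥ w := by
    rw [dotProduct_mulVec, ← mulVec_transpose, hH.eq, dotProduct_comm]
  simp only [qobj, mulVec_sub, dotProduct_sub, sub_dotProduct, add_dotProduct, hsymm,
    dotProduct_comm (H *ᵥ w)]
  ring

/-- A KKT point of a restricted subproblem whose frozen multipliers are all nonnegative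
minimizes the objective over the full feasible set. -/
lemma KKT.qobj_le {c : Fin N → ℝ} {H : Matrix (Fin N) (Fin N) ℝ} (hH : H.PosSemidef)
    {A : Matrix (Fin M) (Fin N) ℝ} {b : Fin M → ℝ} {l u : Fin N → ℝ}
    {L U : Finset (Fin N)} {w : Fin N → ℝ} {ν : Fin M → ℝ} {γl γu βl βu : Fin N → ℝ}
    (h : KKT c H A b l u L U w ν γl γu βl βu) (hw : rfeas A b l u L U w)
    (hβl : ∀ i ∈ L, 0 ≤ βl i) (hβu : ∀ i ∈ U, 0 ≤ βu i)
    {w' : Fin N → ℝ} (hw' : feas A b l u w') :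
    qobj c H w ≤ qobj c H w' := by
  obtain ⟨⟨hAw, -⟩, hwL, hwU⟩ := hw
  obtain ⟨hAw', hbd⟩ := hw'
  have hexp := qobj_sub_qobj (c := c) (isHermitian_iff_isSymm.mp hH.isHermitian) w w'
  have hquad : 0 ≤ (w' - w) ⬝ᵥ H *ᵥ (w' - w) := by
    simpa using hH.dotProduct_mulVec_nonneg (w' - w)
  have hν : (Aᵀ *ᵥ ν) ⬝ᵥ (w' - w) = 0 := by
    rw [mulVec_transpose, ← dotProduct_mulVec, mulVec_sub, hAw, hAw', sub_self,
      dotProduct_zero]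
  have hgrad : 0 ≤ (c + H *ᵥ w + Aᵀ *ᵥ ν) ⬝ᵥ (w' - w) := by
    refine Finset.sum_nonneg fun j _ => ?_
    have hs : (c + H *ᵥ w + Aᵀ *ᵥ ν) j = (if j ∈ L then βl j else 0)
        - (if j ∈ U then βu j else 0) + (if j ∉ L ∪ U then γl j - γu j else 0) := by
      have := h.stationarity j
      simp only [Pi.add_apply]
      linarith
    have hL : 0 ≤ (if j ∈ L then βl j else 0) * (w' j - w j) := by
      split_ifs with hj
      · exact mul_nonneg (hβl j hj) (by linarith [hwL j hj, (hbd j).1])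
      · simp
    have hU : 0 ≤ (if j ∈ U then βu j else 0) * (w j - w' j) := by
      split_ifs with hj
      · exact mul_nonneg (hβu j hj) (by linarith [hwU j hj, (hbd j).2])
      · simp
    have hF : 0 ≤ (if j ∉ L ∪ U then γl j - γu j else 0) * (w' j - w j) := by
      split_ifs with hj
      · simp
      · have h1 := mul_nonneg (h.γl_nonneg j hj) (sub_nonneg.mpr (hbd j).1)
        have h2 := mul_nonneg (h.γu_nonneg j hj) (sub_nonneg.mpr (hbd j).2)
        linarith [h.compl_l j hj, h.compl_u j hj]
    rw [hs, Pi.sub_apply]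
    linarith
  rw [add_dotProduct, hν] at hgrad
  linarith

/-- A sequence of finite sets that strictly decreases whenever `P` fails satisfies `P` at some
index bounded by the size of its first set. -/
lemma exists_le_card_of_ssubset {α : Type*} (W : ℕ → Finset α) (P : ℕ → Prop)
    (hW : ∀ k, ¬ P k → W (k + 1) ⊂ W k) : ∃ k ≤ (W 0).card, P k := by
  by_contra! hP
  have hcard : ∀ k ≤ (W 0).card + 1, (W k).card + k ≤ (W 0).card := by
    intro k
    induction k with
    | zero => simp
    | succ k ih =>
      intro hk
      have := Finset.card_lt_card (hW k (hP k (by omega)))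
      have := ih (by omega)
      omega
  have := hcard _ le_rfl
  omega

theorem active_set_strategy_converges
    (N M : ℕ) (c : Fin N → ℝ) (H : Matrix (Fin N) (Fin N) ℝ) (hH : H.PosDef)
    (A : Matrix (Fin M) (Fin N) ℝ) (b : Fin M → ℝ) (l u : Fin N → ℝ)
    (hfeas : ∃ w, feas A b l u w)
    -- Algorithm 2: sequences of working sets, iterates, and KKT multipliers
    (Ls Us : ℕ → Finset (Fin N))
    (w : ℕ → Fin N → ℝ)
    (ν : ℕ → Fin M → ℝ) (γl γu βl βu : ℕ → Fin N → ℝ)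
    -- the initial working sets are disjoint and the initial restricted subproblem is feasible
    (hdisj0 : Disjoint (Ls 0) (Us 0))
    (hfeas0 : ∃ w0, rfeas A b l u (Ls 0) (Us 0) w0)
    -- at each iteration, w^k is the optimal solution of the restricted subproblem
    (hopt : ∀ k, rfeas A b l u (Ls k) (Us k) (w k) ∧
      ∀ w', rfeas A b l u (Ls k) (Us k) w' → qobj c H (w k) ≤ qobj c H w')
    -- together with a choice of KKT multipliers
    (hKKT : ∀ k, KKT c H A b l u (Ls k) (Us k) (w k) (ν k) (γl k) (γu k) (βl k) (βu k))
    -- working-set update: drop the indices with negative multipliers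
    (hLupd : ∀ k i, i ∈ Ls (k + 1) ↔ i ∈ Ls k ∧ ¬ βl k i < 0)
    (hUupd : ∀ k i, i ∈ Us (k + 1) ↔ i ∈ Us k ∧ ¬ βu k i < 0) :
    -- within |L̄^0 ∪ Ū^0| iterations the algorithm stops at the optimal solution of the QP
    ∃ k ≤ (Ls 0 ∪ Us 0).card,
      (∀ i ∈ Ls k, 0 ≤ βl k i) ∧ (∀ i ∈ Us k, 0 ≤ βu k i) ∧
      feas A b l u (w k) ∧
      (∀ w', feas A b l u w' → qobj c H (w k) ≤ qobj c H w') := by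
  obtain ⟨k, hk, hl, hu⟩ := exists_le_card_of_ssubset (fun k => Ls k ∪ Us k)
    (fun k => (∀ i ∈ Ls k, 0 ≤ βl k i) ∧ (∀ i ∈ Us k, 0 ≤ βu k i)) fun k hneg => by
      have hLsub : Ls (k + 1) ⊆ Ls k := fun i hi => ((hLupd k i).mp hi).1
      have hUsub : Us (k + 1) ⊆ Us k := fun i hi => ((hUupd k i).mp hi).1
      have hdisj : ∀ k, Disjoint (Ls k) (Us k) := fun k => by
        induction k with
        | zero => exact hdisj0
        | succ k ih =>
          exact ih.mono (fun i hi => ((hLupd k i).mp hi).1) fun i hi => ((hUupd k i).mp hi).1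
      refine (Finset.ssubset_iff_of_subset (Finset.union_subset_union hLsub hUsub)).mpr ?_
      rw [not_and_or] at hneg
      push Not at hneg
      rcases hneg with ⟨i, hi, hβ⟩ | ⟨i, hi, hβ⟩
      · refine ⟨i, Finset.mem_union_left _ hi, fun hmem => ?_⟩
        rcases Finset.mem_union.mp hmem with h | h
        · exact ((hLupd k i).mp h).2 hβ
        · exact Finset.disjoint_left.mp (hdisj k) hi (hUsub h)
      · refine ⟨i, Finset.mem_union_right _ hi, fun hmem => ?_⟩
        rcases Finset.mem_union.mp hmem with h | h
        · exact Finset.disjoint_left.mp (hdisj k) (hLsub h) hi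
        · exact ((hUupd k i).mp h).2 hβ
  exact ⟨k, hk, hl, hu, (hopt k).1.1,
    fun w' hw' => (hKKT k).qobj_le hH.posSemidef (hopt k).1 hl hu hw'⟩
end
end
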